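/- Let n = 1 and assume f : ℝ × D × [0,ε₀] → ℝ satisfies conditions A.1–A.3 and is T-periodic in t, where D ⊆ ℝ is open. Let a < b with [a,b] ⊂ D, and suppose f₁(a)·f₁(b) < 0, where f₁ is the averaged function. Then there exists ε_V ∈ (0,ε₀] such that for every ε ∈ [0,ε_V] the differential equation x′ = ε f(t,x,ε) admits a T-periodic solution φ(·,ε) with φ(t,ε) ∈ (a,b) for every t ∈ [0,T]. -/

import Mathlib

open MeasureTheory Set Filter Topology

/-- A right-hand side `F t x` on `ℝ × ℝ` satisfying the Carathéodory conditions with a single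
integrable majorant `g`. -/
structure DominatedCaratheodory (F : ℝ → ℝ → ℝ) (g : ℝ → ℝ) : Prop where
  continuous : ∀ᵐ t, Continuous (F t)
  aestronglyMeasurable : ∀ x, AEStronglyMeasurable (fun t => F t x) volume
  bound : ∀ᵐ t, ∀ x, |F t x| ≤ g t
  integrable : Integrable g

/-- The superposition `t ↦ F t (Y t)` of a Carathéodory function with a strongly measurable
function is almost everywhere strongly measurable. -/
theorem aestronglyMeasurable_superposition {μ : Measure ℝ} {F : ℝ → ℝ → ℝ}
    (hc : ∀ᵐ t ∂μ, Continuous (F t)) (hm : ∀ x, AEStronglyMeasurable (fun t => F t x) μ)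
    {Y : ℝ → ℝ} (hY : StronglyMeasurable Y) :
    AEStronglyMeasurable (fun t => F t (Y t)) μ := by
  have simple : ∀ S : SimpleFunc ℝ ℝ, AEStronglyMeasurable (fun t => F t (S t)) μ := by
    intro S
    have hsum : (fun t => F t (S t)) =
        fun t => ∑ c ∈ S.range, (S ⁻¹' {c}).indicator (fun t => F t c) t := by
      funext t
      rw [Finset.sum_eq_single (S t)]
      · simp
      · intro c _ hc
        exact indicator_of_notMem (by simpa using hc.symm) _
      · intro h
        exact absurd (S.mem_range_self t) h
    rw [hsum]
    exact Finset.aestronglyMeasurable_fun_sum _ fun c _ =>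
      (hm c).indicator (S.measurableSet_fiber c)
  refine aestronglyMeasurable_of_tendsto_ae atTop (fun n => simple (hY.approx n)) ?_
  filter_upwards [hc] with t ht
  exact (ht.tendsto _).comp (hY.tendsto_approx t)

namespace DominatedCaratheodory

variable {F : ℝ → ℝ → ℝ} {g : ℝ → ℝ}

theorem integrable_superposition (hF : DominatedCaratheodory F g) {Y : ℝ → ℝ}
    (hY : StronglyMeasurable Y) : Integrable (fun t => F t (Y t)) :=
  hF.integrable.mono'
    (aestronglyMeasurable_superposition hF.continuous hF.aestronglyMeasurable hY)
    (hF.bound.mono fun t ht => ht (Y t))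

theorem abs_integral_le_abs (hF : DominatedCaratheodory F g) (Y : ℝ → ℝ) (u v : ℝ) :
    |∫ s in u..v, F s (Y s)| ≤ |∫ s in u..v, g s| := by
  rw [← Real.norm_eq_abs]
  exact intervalIntegral.norm_integral_le_abs_of_norm_le
    (ae_restrict_of_ae (hF.bound.mono fun t ht => ht (Y t))) hF.integrable.intervalIntegrable

theorem abs_integral_le (hF : DominatedCaratheodory F g) (Y : ℝ → ℝ) (u v : ℝ) :
    |∫ s in u..v, F s (Y s)| ≤ ∫ s, g s := by
  refine (hF.abs_integral_le_abs Y u v).trans ?_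
  have hg : 0 ≤ᵐ[volume] g := hF.bound.mono fun t ht => (abs_nonneg _).trans (ht 0)
  rw [intervalIntegral.abs_intervalIntegral_eq, abs_of_nonneg (integral_nonneg_of_ae
    (ae_restrict_of_ae hg))]
  exact setIntegral_le_integral hF.integrable hg

theorem tendsto_integral (hF : DominatedCaratheodory F g) {Y : ℕ → ℝ → ℝ} {y : ℝ → ℝ} {u v : ℝ}
    (hY : ∀ n, StronglyMeasurable (Y n))
    (h : ∀ s ∈ uIoc u v, Tendsto (fun n => Y n s) atTop (𝓝 (y s))) :
    Tendsto (fun n => ∫ s in u..v, F s (Y n s)) atTop (𝓝 (∫ s in u..v, F s (y s))) := by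
  refine intervalIntegral.tendsto_integral_filter_of_dominated_convergence g
    (.of_forall fun n => (hF.integrable_superposition (hY n)).aestronglyMeasurable.restrict)
    (.of_forall fun n => hF.bound.mono fun t ht _ => ht _)
    hF.integrable.intervalIntegrable ?_
  filter_upwards [hF.continuous] with t ht hmem
  exact (ht.tendsto _).comp (h t hmem)

end DominatedCaratheodory

/-- The values at the nodes `k * h` of the Euler-type approximation of `x′ = F t x`, `x 0 = z`. -/
noncomputable def eulerNode (F : ℝ → ℝ → ℝ) (h z : ℝ) : ℕ → ℝ
  | 0 => z
  | k + 1 => eulerNode F h z k +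
      ∫ s in (k * h)..((k + 1 : ℕ) * h), F s (eulerNode F h z k)

/-- The step function with value `eulerNode F h z k` on `[k * h, (k + 1) * h)`. -/
noncomputable def eulerStep (F : ℝ → ℝ → ℝ) (h z s : ℝ) : ℝ :=
  eulerNode F h z ⌊s / h⌋₊

theorem stronglyMeasurable_eulerStep (F : ℝ → ℝ → ℝ) (h z : ℝ) :
    StronglyMeasurable (eulerStep F h z) := by
  have : Measurable (fun s : ℝ => ⌊s / h⌋₊) := Nat.measurable_floor.comp (measurable_id.div_const h)
  exact ((measurable_from_nat (f := eulerNode F h z)).comp this).stronglyMeasurable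

namespace DominatedCaratheodory

variable {F : ℝ → ℝ → ℝ} {g : ℝ → ℝ}

theorem continuous_eulerNode (hF : DominatedCaratheodory F g) (h : ℝ) (k : ℕ) :
    Continuous fun z => eulerNode F h z k := by
  induction k with
  | zero => exact continuous_id
  | succ k ih =>
    refine ih.add (intervalIntegral.continuous_of_dominated_interval (bound := g)
      (fun z => (hF.aestronglyMeasurable _).restrict)
      (fun z => hF.bound.mono fun t ht _ => ht _) hF.integrable.intervalIntegrable ?_)
    filter_upwards [hF.continuous] with t ht _
    exact ht.comp ih

theorem continuous_integral_eulerStep (hF : DominatedCaratheodory F g) (h u v : ℝ) :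
    Continuous fun z => ∫ s in u..v, F s (eulerStep F h z s) := by
  refine intervalIntegral.continuous_of_dominated_interval (bound := g)
    (fun z => (hF.integrable_superposition
      (stronglyMeasurable_eulerStep F h z)).aestronglyMeasurable.restrict)
    (fun z => hF.bound.mono fun t ht _ => ht _) hF.integrable.intervalIntegrable ?_
  filter_upwards [hF.continuous] with t ht _
  exact ht.comp (hF.continuous_eulerNode h _)

theorem eulerNode_eq_add_integral (hF : DominatedCaratheodory F g) {h : ℝ} (hh : 0 < h) (z : ℝ)
    (k : ℕ) : eulerNode F h z k = z + ∫ s in (0 : ℝ)..(k * h), F s (eulerStep F h z s) := by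
  induction k with
  | zero => simp [eulerNode]
  | succ k ih =>
    have hint := hF.integrable_superposition (stronglyMeasurable_eulerStep F h z)
    have hstep : ∫ s in (k * h)..((k + 1 : ℕ) * h), F s (eulerNode F h z k) =
        ∫ s in (k * h)..((k + 1 : ℕ) * h), F s (eulerStep F h z s) := by
      refine intervalIntegral.integral_congr_Ioo_of_le
        (by push_cast; nlinarith) fun s hs => ?_
      have hfl : ⌊s / h⌋₊ = k := by
        rw [Nat.floor_eq_iff (div_nonneg ((by positivity : (0 : ℝ) ≤ k * h).trans hs.1.le) hh.le)]
        have h2 := hs.2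
        push_cast at h2
        exact ⟨(le_div_iff₀ hh).2 hs.1.le, (div_lt_iff₀ hh).2 h2⟩
      simp only [eulerStep, hfl]
    rw [eulerNode, hstep, ← intervalIntegral.integral_add_adjacent_intervals
      (hint.intervalIntegrable (a := 0) (b := k * h)) hint.intervalIntegrable, ← add_assoc, ← ih]

theorem abs_eulerStep_sub_le (hF : DominatedCaratheodory F g) {h : ℝ} (hh : 0 < h) (z s : ℝ) :
    |eulerStep F h z s - z| ≤ ∫ t, g t := by
  rw [eulerStep, hF.eulerNode_eq_add_integral hh, add_sub_cancel_left]
  exact hF.abs_integral_le _ _ _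

theorem abs_eulerStep_sub_integral_le (hF : DominatedCaratheodory F g) {h : ℝ} (hh : 0 < h)
    (z s : ℝ) :
    |eulerStep F h z s - (z + ∫ t in (0 : ℝ)..s, F t (eulerStep F h z t))| ≤
      |∫ t in s..(⌊s / h⌋₊ * h), g t| := by
  have hint := hF.integrable_superposition (stronglyMeasurable_eulerStep F h z)
  have : eulerStep F h z s - (z + ∫ t in (0 : ℝ)..s, F t (eulerStep F h z t)) =
      ∫ t in s..(⌊s / h⌋₊ * h), F t (eulerStep F h z t) := by
    rw [eulerStep, hF.eulerNode_eq_add_integral hh, add_sub_add_left_eq_sub,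
      intervalIntegral.integral_interval_sub_left hint.intervalIntegrable hint.intervalIntegrable]
  rw [this]
  exact hF.abs_integral_le_abs _ _ _

end DominatedCaratheodory

theorem tendsto_floor_div_mul {ι : Type*} {l : Filter ι} {h : ι → ℝ} (hpos : ∀ i, 0 < h i)
    (hlim : Tendsto h l (𝓝 0)) {s : ℝ} (hs : 0 ≤ s) :
    Tendsto (fun i => (⌊s / h i⌋₊ : ℝ) * h i) l (𝓝 s) := by
  refine tendsto_of_tendsto_of_tendsto_of_le_of_le (g := fun i => s - h i) (h := fun _ => s)
    (by simpa using hlim.const_sub s) tendsto_const_nhds (fun i => ?_) (fun i => ?_)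
  · have := (div_lt_iff₀ (hpos i)).1 (Nat.lt_floor_add_one (s / h i))
    simp only
    linarith
  · exact (le_div_iff₀ (hpos i)).1 (Nat.floor_le (div_nonneg hs (hpos i).le))

/-- Arzelà–Ascoli for sequences of real functions sharing a continuous modulus `G`. -/
theorem exists_continuous_subseq_tendsto {T : ℝ} (hT : 0 ≤ T) {G : ℝ → ℝ} (hG : Continuous G)
    {x : ℕ → ℝ → ℝ} (hx : ∀ n s t, |x n s - x n t| ≤ |G s - G t|) {M : ℝ}
    (hM : ∀ n, ∀ t ∈ Icc 0 T, |x n t| ≤ M) :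
    ∃ φ : ℝ → ℝ, Continuous φ ∧ ∃ θ : ℕ → ℕ, StrictMono θ ∧
      ∀ t ∈ Icc 0 T, Tendsto (fun n => x (θ n) t) atTop (𝓝 (φ t)) := by
  have hcont : ∀ n, Continuous (x n) := fun n => continuous_iff_continuousAt.2 fun t =>
    tendsto_iff_norm_sub_tendsto_zero.2 <| squeeze_zero (fun s => norm_nonneg _)
      (fun s => hx n s t) (tendsto_iff_norm_sub_tendsto_zero.1 (hG.tendsto t))
  let X : ℕ → BoundedContinuousFunction (Icc 0 T) ℝ := fun n =>
    BoundedContinuousFunction.mkOfCompact ⟨fun t => x n t, (hcont n).comp continuous_subtype_val⟩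
  have hK : IsCompact (closure (range X)) := by
    refine BoundedContinuousFunction.arzela_ascoli (Metric.closedBall 0 M)
      (isCompact_closedBall 0 M) _ ?_ ?_
    · rintro _ t ⟨n, rfl⟩
      rw [mem_closedBall_zero_iff]
      exact hM n t t.2
    · refine fun t => Metric.equicontinuousAt_of_continuity_modulus
        (fun s : Icc 0 T => |G t - G s|) ?_ _ (.of_forall ?_)
      · have : Continuous fun s : Icc 0 T => |G t - G s| := by fun_prop
        simpa using this.tendsto t
      · rintro s ⟨_, n, rfl⟩
        exact hx n t s
  obtain ⟨ψ, -, θ, hθ, hlim⟩ := hK.tendsto_subseq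
    (fun n => subset_closure (mem_range_self (f := X) n))
  refine ⟨IccExtend hT ψ, ψ.continuous.Icc_extend', θ, hθ, fun t ht => ?_⟩
  rw [IccExtend_of_mem hT ψ ht]
  exact ((BoundedContinuousFunction.tendsto_iff_tendstoUniformly.1 hlim).tendsto_at ⟨t, ht⟩)

namespace DominatedCaratheodory

variable {F : ℝ → ℝ → ℝ} {g : ℝ → ℝ}

/-- If the displacement over `[0, T]` has opposite signs along all curves close to `a` and all
curves close to `b`, some solution starting in `[a, b]` returns to its initial value at time `T`. -/
theorem exists_solution_integral_eq_zero (hF : DominatedCaratheodory F g) {T a b c : ℝ}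
    (hT : 0 < T) (hab : a ≤ b)
    (ha : ∀ Y, StronglyMeasurable Y → (∀ s ∈ Ioc 0 T, |Y s - a| ≤ ∫ t, g t) →
      0 < c * ∫ s in (0 : ℝ)..T, F s (Y s))
    (hb : ∀ Y, StronglyMeasurable Y → (∀ s ∈ Ioc 0 T, |Y s - b| ≤ ∫ t, g t) →
      c * ∫ s in (0 : ℝ)..T, F s (Y s) < 0) :
    ∃ φ : ℝ → ℝ, Continuous φ ∧ φ 0 ∈ Icc a b ∧
      (∀ t ∈ Icc 0 T, φ t = φ 0 + ∫ s in (0 : ℝ)..t, F s (φ s)) ∧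
      ∫ s in (0 : ℝ)..T, F s (φ s) = 0 := by
  have hc : c ≠ 0 := by
    rintro rfl
    simpa using ha (fun _ => a) stronglyMeasurable_const fun s _ => by
      simpa using integral_nonneg_of_ae
        (hF.bound.mono fun t ht => (abs_nonneg _).trans (ht 0))
  let h : ℕ → ℝ := fun n => T / (n + 1)
  have hpos : ∀ n, 0 < h n := fun n => by positivity
  have hlim : Tendsto h atTop (𝓝 0) := by
    simpa [h, div_eq_mul_inv] using
      (tendsto_one_div_add_atTop_nhds_zero_nat (𝕜 := ℝ)).const_mul T
  have hroot : ∀ n, ∃ z ∈ Icc a b, ∫ s in (0 : ℝ)..T, F s (eulerStep F (h n) z s) = 0 := by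
    intro n
    obtain ⟨z, hz, h0⟩ := intermediate_value_Icc' hab
      ((hF.continuous_integral_eulerStep (h n) 0 T).const_mul c).continuousOn
      ⟨(hb _ (stronglyMeasurable_eulerStep F (h n) b)
          fun s _ => hF.abs_eulerStep_sub_le (hpos n) b s).le,
        (ha _ (stronglyMeasurable_eulerStep F (h n) a)
          fun s _ => hF.abs_eulerStep_sub_le (hpos n) a s).le⟩
    exact ⟨z, hz, (mul_eq_zero.1 h0).resolve_left hc⟩
  choose z hz hz0 using hroot
  let Y : ℕ → ℝ → ℝ := fun n => eulerStep F (h n) (z n)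
  have hY : ∀ n, StronglyMeasurable (Y n) := fun n => stronglyMeasurable_eulerStep F (h n) (z n)
  let x : ℕ → ℝ → ℝ := fun n t => z n + ∫ s in (0 : ℝ)..t, F s (Y n s)
  let G : ℝ → ℝ := fun t => ∫ s in (0 : ℝ)..t, g s
  have hG : Continuous G :=
    intervalIntegral.continuous_primitive (fun _ _ => hF.integrable.intervalIntegrable) 0
  have hGsub : ∀ s t, ∫ r in s..t, g r = G t - G s := fun s t =>
    (intervalIntegral.integral_interval_sub_left hF.integrable.intervalIntegrable
      hF.integrable.intervalIntegrable).symm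
  have hx : ∀ n s t, |x n s - x n t| ≤ |G s - G t| := by
    intro n s t
    have hint := hF.integrable_superposition (hY n)
    rw [← hGsub, add_sub_add_left_eq_sub, intervalIntegral.integral_interval_sub_left
      hint.intervalIntegrable hint.intervalIntegrable]
    exact hF.abs_integral_le_abs _ _ _
  have hM : ∀ n, ∀ t ∈ Icc 0 T, |x n t| ≤ max |a| |b| + ∫ t, g t := fun n t _ =>
    (abs_add_le _ _).trans
      (add_le_add (abs_le_max_abs_abs (hz n).1 (hz n).2) (hF.abs_integral_le _ _ _))
  obtain ⟨φ, hφ, θ, hθ, hxφ⟩ := exists_continuous_subseq_tendsto hT.le hG hx hM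
  have hYφ : ∀ s ∈ Icc 0 T, Tendsto (fun n => Y (θ n) s) atTop (𝓝 (φ s)) := by
    intro s hs
    have hsmall : Tendsto (fun n => Y (θ n) s - x (θ n) s) atTop (𝓝 0) := by
      refine squeeze_zero_norm
        (fun n => hF.abs_eulerStep_sub_integral_le (hpos (θ n)) (z (θ n)) s) ?_
      have := ((hG.tendsto s).comp (tendsto_floor_div_mul (fun n => hpos (θ n))
        (hlim.comp hθ.tendsto_atTop) hs.1)).sub_const (G s)
      simpa [hGsub] using this.abs
    simpa using hsmall.add (hxφ s hs)
  have hint : ∀ t ∈ Icc 0 T, Tendsto (fun n => ∫ s in (0 : ℝ)..t, F s (Y (θ n) s)) atTop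
      (𝓝 (∫ s in (0 : ℝ)..t, F s (φ s))) := by
    refine fun t ht => hF.tendsto_integral (fun n => hY (θ n)) fun s hs => hYφ s ?_
    rw [uIoc_of_le ht.1] at hs
    exact ⟨hs.1.le, hs.2.trans ht.2⟩
  have hz' : Tendsto (fun n => z (θ n)) atTop (𝓝 (φ 0)) := by
    simpa [x] using hxφ 0 ⟨le_rfl, hT.le⟩
  refine ⟨φ, hφ, isClosed_Icc.mem_of_tendsto hz' (.of_forall fun n => hz (θ n)),
    fun t ht => tendsto_nhds_unique (hxφ t ht) (hz'.add (hint t ht)), ?_⟩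
  refine tendsto_nhds_unique (hint T ⟨hT.le, le_rfl⟩) ?_
  simp only [Y, hz0]
  exact tendsto_const_nhds

/-- The solution found in `exists_solution_integral_eq_zero` stays in the open interval. -/
theorem exists_solution_mem_Ioo (hF : DominatedCaratheodory F g) {T a b c : ℝ}
    (hT : 0 < T) (hab : a ≤ b)
    (ha : ∀ Y, StronglyMeasurable Y → (∀ s ∈ Ioc 0 T, |Y s - a| ≤ ∫ t, g t) →
      0 < c * ∫ s in (0 : ℝ)..T, F s (Y s))
    (hb : ∀ Y, StronglyMeasurable Y → (∀ s ∈ Ioc 0 T, |Y s - b| ≤ ∫ t, g t) →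
      c * ∫ s in (0 : ℝ)..T, F s (Y s) < 0) :
    ∃ φ : ℝ → ℝ, Continuous φ ∧ (∀ t ∈ Icc 0 T, φ t ∈ Ioo a b) ∧
      (∀ t ∈ Icc 0 T, φ t = φ 0 + ∫ s in (0 : ℝ)..t, F s (φ s)) ∧
      ∫ s in (0 : ℝ)..T, F s (φ s) = 0 := by
  obtain ⟨φ, hφ, h0, heq, hper⟩ := hF.exists_solution_integral_eq_zero hT hab ha hb
  have hosc : ∀ s ∈ Icc 0 T, ∀ t ∈ Icc 0 T, |φ s - φ t| ≤ ∫ r, g r := by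
    intro s hs t ht
    have hint := hF.integrable_superposition hφ.stronglyMeasurable
    rw [heq s hs, heq t ht, add_sub_add_left_eq_sub, intervalIntegral.integral_interval_sub_left
      hint.intervalIntegrable hint.intervalIntegrable]
    exact hF.abs_integral_le _ _ _
  have h0T : (0 : ℝ) ∈ Icc 0 T := ⟨le_rfl, hT.le⟩
  refine ⟨φ, hφ, fun t ht => ⟨?_, ?_⟩, heq, hper⟩
  · by_contra! hle
    have := ha φ hφ.stronglyMeasurable fun s hs => by
      have h1 := abs_le.1 (hosc s (Ioc_subset_Icc_self hs) t ht)
      have h2 := abs_le.1 (hosc s (Ioc_subset_Icc_self hs) 0 h0T)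
      exact abs_le.2 ⟨by linarith [h0.1], by linarith⟩
    simp [hper] at this
  · by_contra! hle
    have := hb φ hφ.stronglyMeasurable fun s hs => by
      have h1 := abs_le.1 (hosc s (Ioc_subset_Icc_self hs) t ht)
      have h2 := abs_le.1 (hosc s (Ioc_subset_Icc_self hs) 0 h0T)
      exact abs_le.2 ⟨by linarith, by linarith [h0.2]⟩
    simp [hper] at this

end DominatedCaratheodory

/-- The integral of `H t x ε` along curves `x = Y t` close to `z`, for `ε` small, has the sign of
its value at `x = z`, `ε = 0`. -/
theorem exists_pos_forall_integral_mul_pos {H : ℝ → ℝ → ℝ → ℝ} {g : ℝ → ℝ} {ε₀ T z : ℝ}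
    (hε₀ : 0 < ε₀) (hT : 0 ≤ T)
    (hH : ∀ ε ∈ Icc 0 ε₀, DominatedCaratheodory (fun t x => H t x ε) g)
    (hc : ∀ᵐ t, ContinuousOn (fun p : ℝ × ℝ => H t p.1 p.2) (univ ×ˢ Icc 0 ε₀))
    (hne : ∫ t in (0 : ℝ)..T, H t z 0 ≠ 0) :
    ∃ η > 0, ∀ ε ∈ Icc 0 ε₀, ε ≤ η → ∀ Y, StronglyMeasurable Y →
      (∀ s ∈ Ioc 0 T, |Y s - z| ≤ η) →
      0 < (∫ t in (0 : ℝ)..T, H t z 0) * ∫ t in (0 : ℝ)..T, H t (Y t) ε := by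
  by_contra! hcon
  choose ε hε hεη Y hY hYη hle using fun n : ℕ => hcon (1 / ((n : ℝ) + 1)) (by positivity)
  have hlim0 : Tendsto (fun n : ℕ => 1 / ((n : ℝ) + 1)) atTop (𝓝 0) :=
    tendsto_one_div_add_atTop_nhds_zero_nat
  have hε0 : Tendsto ε atTop (𝓝 0) := squeeze_zero (fun n => (hε n).1) hεη hlim0
  have hlim : Tendsto (fun n => ∫ t in (0 : ℝ)..T, H t (Y n t) (ε n)) atTop
      (𝓝 (∫ t in (0 : ℝ)..T, H t z 0)) := by
    have h00 : (0 : ℝ) ∈ Icc 0 ε₀ := ⟨le_rfl, hε₀.le⟩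
    refine intervalIntegral.tendsto_integral_filter_of_dominated_convergence g
      (.of_forall fun n =>
        ((hH _ (hε n)).integrable_superposition (hY n)).aestronglyMeasurable.restrict)
      (.of_forall fun n => (hH _ (hε n)).bound.mono fun t ht _ => ht _)
      (hH 0 h00).integrable.intervalIntegrable ?_
    filter_upwards [hc] with t ht hmem
    rw [uIoc_of_le hT] at hmem
    have hYz : Tendsto (fun n => Y n t) atTop (𝓝 z) :=
      tendsto_iff_norm_sub_tendsto_zero.2 <|
        squeeze_zero (fun n => norm_nonneg _) (fun n => hYη n t hmem) hlim0
    exact (ht (z, 0) ⟨mem_univ _, h00⟩).tendsto.comp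
      (tendsto_nhdsWithin_iff.2 ⟨hYz.prodMk_nhds hε0, .of_forall fun n => ⟨mem_univ _, hε n⟩⟩)
  exact absurd (le_of_tendsto (hlim.const_mul _) (.of_forall hle)) (mul_self_pos.2 hne).not_ge

/-- A solution on `[0, T]` of an equation with `T`-periodic right-hand side whose displacement
over `[0, T]` vanishes extends to a `T`-periodic solution. -/
theorem exists_periodic_extension {q : ℝ → ℝ → ℝ} {T : ℝ} (hT : 0 < T)
    (hq : ∀ t x, q (t + T) x = q t x) {φ : ℝ → ℝ}
    (hint : IntervalIntegrable (fun s => q s (φ s)) volume 0 T)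
    (heq : ∀ t ∈ Icc 0 T, φ t = φ 0 + ∫ s in (0 : ℝ)..t, q s (φ s))
    (hper : ∫ s in (0 : ℝ)..T, q s (φ s) = 0) :
    ∃ ψ : ℝ → ℝ, Function.Periodic ψ T ∧ (∀ t, ∃ s ∈ Icc 0 T, ψ t = φ s) ∧
      (∀ u v, IntervalIntegrable (fun s => q s (ψ s)) volume u v) ∧
      ∀ u v, ψ v - ψ u = ∫ s in u..v, q s (ψ s) := by
  let ψ : ℝ → ℝ := fun t => φ (toIcoMod hT 0 t)
  have hψper : Function.Periodic ψ T := fun t => congrArg φ (toIcoMod_add_right hT 0 t)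
  have hψφ : ∀ t ∈ Ico 0 T, ψ t = φ t := fun t ht =>
    congrArg φ ((toIcoMod_eq_self hT).2 (by simpa using ht))
  have hwper : Function.Periodic (fun s => q s (ψ s)) T := fun t => by
    simp only [hq, hψper t]
  have hcongr : ∀ t ∈ Icc 0 T, ∫ s in (0 : ℝ)..t, q s (ψ s) = ∫ s in (0 : ℝ)..t, q s (φ s) :=
    fun t ht => intervalIntegral.integral_congr_Ioo_of_le ht.1 fun s hs => by
      simp only [hψφ s ⟨hs.1.le, hs.2.trans_le ht.2⟩]
  have hwint : ∀ u v, IntervalIntegrable (fun s => q s (ψ s)) volume u v := by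
    refine hwper.intervalIntegrable₀ hT.ne' (hint.congr_uIoo fun s hs => ?_)
    rw [uIoo_of_le hT.le] at hs
    simp only [hψφ s ⟨hs.1.le, hs.2⟩]
  have hWper : Function.Periodic (fun t => ∫ s in (0 : ℝ)..t, q s (ψ s)) T := fun t => by
    have hz := hwper.intervalIntegral_add_eq_add 0 t hwint
    rw [zero_add, hcongr T ⟨hT.le, le_rfl⟩, hper, add_zero] at hz
    exact hz
  have hW : ∀ t, ψ t = φ 0 + ∫ s in (0 : ℝ)..t, q s (ψ s) := by
    intro t
    have hmem : toIcoMod hT 0 t ∈ Icc 0 T := Ico_subset_Icc_self (toIcoMod_mem_Ico' hT t)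
    have hred : ∫ s in (0 : ℝ)..(toIcoMod hT 0 t), q s (ψ s) = ∫ s in (0 : ℝ)..t, q s (ψ s) :=
      hWper.sub_zsmul_eq (toIcoDiv hT 0 t)
    rw [← hred, hcongr _ hmem]
    exact heq _ hmem
  refine ⟨ψ, hψper, fun t => ⟨_, Ico_subset_Icc_self (toIcoMod_mem_Ico' hT t), rfl⟩, hwint,
    fun u v => ?_⟩
  rw [hW u, hW v, add_sub_add_left_eq_sub,
    intervalIntegral.integral_interval_sub_left (hwint _ _) (hwint _ _)]

theorem DominatedCaratheodory.const_mul {F : ℝ → ℝ → ℝ} {g : ℝ → ℝ}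
    (hF : DominatedCaratheodory F g) {r : ℝ} (hr : 0 ≤ r) :
    DominatedCaratheodory (fun t x => r * F t x) (fun t => r * g t) where
  continuous := hF.continuous.mono fun _ ht => ht.const_mul r
  aestronglyMeasurable x := (hF.aestronglyMeasurable x).const_mul r
  bound := hF.bound.mono fun t ht x => by
    rw [abs_mul, abs_of_nonneg hr]
    exact mul_le_mul_of_nonneg_left (ht x) hr
  integrable := hF.integrable.const_mul r

/-- Restricting a Carathéodory family to times in `(0, T]` and freezing it in `x` outside of
`[a, b]` gives a globally dominated Carathéodory family. -/
theorem exists_dominatedCaratheodory_indicator_clamp {D : Set ℝ} {T ε₀ : ℝ}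
    {f : ℝ → ℝ → ℝ → ℝ}
    (hA1 : ∀ᵐ t ∂(volume.restrict (Icc (0:ℝ) T)),
      ContinuousOn (fun p : ℝ × ℝ => f t p.1 p.2) (D ×ˢ Icc (0:ℝ) ε₀))
    (hA2 : ∀ x ∈ D, ∀ ε ∈ Icc (0:ℝ) ε₀,
      AEStronglyMeasurable (fun t => f t x ε) (volume.restrict (Icc (0:ℝ) T)))
    (hA3 : ∀ r > (0:ℝ), ∃ g : ℝ → ℝ, IntegrableOn g (Icc (0:ℝ) T) ∧
      ∀ᵐ t ∂(volume.restrict (Icc (0:ℝ) T)),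
        ∀ x ∈ D, ∀ ε ∈ Icc (0:ℝ) ε₀, ‖(x, ε)‖ ≤ r → |f t x ε| ≤ g t)
    {a b : ℝ} (hab : a ≤ b) (habD : Icc a b ⊆ D) (hε₀ : 0 < ε₀) :
    ∃ (H : ℝ → ℝ → ℝ → ℝ) (g : ℝ → ℝ),
      (∀ t ∈ Ioc 0 T, ∀ x ∈ Icc a b, ∀ ε, H t x ε = f t x ε) ∧
      (∀ ε ∈ Icc 0 ε₀, DominatedCaratheodory (fun t x => H t x ε) g) ∧
      ∀ᵐ t, ContinuousOn (fun p : ℝ × ℝ => H t p.1 p.2) (univ ×ˢ Icc 0 ε₀) := by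
  obtain ⟨g, hg, hbound⟩ := hA3 (max |a| |b| + ε₀) (by positivity)
  let cl : ℝ → ℝ := fun x => max a (min x b)
  have hcl : Continuous cl := by fun_prop
  have hclmem : ∀ x, cl x ∈ Icc a b := fun x => ⟨le_max_left _ _, max_le hab (min_le_right _ _)⟩
  have hsub : Ioc 0 T ⊆ Icc 0 T := Ioc_subset_Icc_self
  have hcont : ∀ᵐ t, ContinuousOn (fun p : ℝ × ℝ => (Ioc 0 T).indicator
      (fun t => f t (cl p.1) p.2) t) (univ ×ˢ Icc 0 ε₀) := by
    filter_upwards [(ae_restrict_iff' measurableSet_Icc).1 hA1] with t ht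
    by_cases htT : t ∈ Ioc 0 T
    · simp only [indicator_of_mem htT]
      exact (ht (hsub htT)).comp (f := fun p : ℝ × ℝ => (cl p.1, p.2))
        (by fun_prop) fun p hp => ⟨habD (hclmem _), hp.2⟩
    · simp only [indicator_of_notMem htT]
      exact continuousOn_const
  refine ⟨fun t x ε => (Ioc 0 T).indicator (fun t => f t (cl x) ε) t,
    (Ioc 0 T).indicator g, fun t ht x hx ε => ?_, fun ε hε => ⟨?_, fun x => ?_, ?_, ?_⟩, hcont⟩
  · have : cl x = x := by simp only [cl, min_eq_left hx.2, max_eq_right hx.1]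
    simp only [indicator_of_mem ht, this]
  · filter_upwards [hcont] with t ht
    exact ht.comp_continuous (f := fun x : ℝ => (x, ε)) (by fun_prop) fun x => ⟨mem_univ _, hε⟩
  · exact (aestronglyMeasurable_indicator_iff measurableSet_Ioc).2
      ((hA2 _ (habD (hclmem x)) ε hε).mono_set hsub)
  · filter_upwards [(ae_restrict_iff' measurableSet_Icc).1 hbound] with t ht x
    by_cases htT : t ∈ Ioc 0 T
    · simp only [indicator_of_mem htT]
      refine ht (hsub htT) _ (habD (hclmem x)) ε hε ?_
      have h1 : |cl x| ≤ max |a| |b| := abs_le_max_abs_abs (hclmem x).1 (hclmem x).2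
      have h2 : (0 : ℝ) ≤ max |a| |b| := (abs_nonneg a).trans (le_max_left _ _)
      refine max_le ?_ ?_
      · exact h1.trans (by linarith)
      · simp only [Real.norm_eq_abs, abs_of_nonneg hε.1]
        linarith [hε.2]
    · simp [indicator_of_notMem htT]
  · exact (integrable_indicator_iff measurableSet_Ioc).2 (hg.mono_set hsub)

/-- One-dimensional averaging theorem: if `f : ℝ × D × [0,ε₀] → ℝ` is `T`-periodic in `t`
and satisfies the Carathéodory conditions A.1–A.3, `[a,b] ⊂ D`, and the averaged function
`f₁(z) = (1/T)∫₀ᵀ f(t,z,0) dt` satisfies `f₁(a)·f₁(b) < 0`, then there exists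
`ε_V ∈ (0,ε₀]` such that for every `ε ∈ [0,ε_V]` the equation `x′ = ε f(t,x,ε)` has a
`T`-periodic (absolutely continuous) solution with values in `(a,b)` on `[0,T]`. -/
theorem averaging_one_dimensional
    (D : Set ℝ) (hD : IsOpen D)
    (T ε₀ : ℝ) (hT : 0 < T) (hε₀ : 0 < ε₀)
    (f : ℝ → ℝ → ℝ → ℝ)
    (hper : ∀ t x ε, f (t + T) x ε = f t x ε)
    (hA1 : ∀ᵐ t ∂(volume.restrict (Icc (0:ℝ) T)),
      ContinuousOn (fun p : ℝ × ℝ => f t p.1 p.2) (D ×ˢ Icc (0:ℝ) ε₀))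
    (hA2 : ∀ x ∈ D, ∀ ε ∈ Icc (0:ℝ) ε₀,
      AEStronglyMeasurable (fun t => f t x ε) (volume.restrict (Icc (0:ℝ) T)))
    (hA3 : ∀ r > (0:ℝ), ∃ g : ℝ → ℝ, IntegrableOn g (Icc (0:ℝ) T) ∧
      ∀ᵐ t ∂(volume.restrict (Icc (0:ℝ) T)),
        ∀ x ∈ D, ∀ ε ∈ Icc (0:ℝ) ε₀, ‖(x, ε)‖ ≤ r → |f t x ε| ≤ g t)
    (a b : ℝ) (hab : a < b) (habD : Icc a b ⊆ D)
    (hsign : ((1 / T) * ∫ t in (0:ℝ)..T, f t a 0) *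
             ((1 / T) * ∫ t in (0:ℝ)..T, f t b 0) < 0) :
    ∃ εV : ℝ, 0 < εV ∧ εV ≤ ε₀ ∧ ∀ ε ∈ Icc (0:ℝ) εV,
      ∃ φ : ℝ → ℝ,
        (∀ t, φ (t + T) = φ t) ∧
        (∀ t, φ t ∈ D) ∧
        (∀ u v : ℝ, IntervalIntegrable (fun s => ε * f s (φ s) ε) volume u v) ∧
        (∀ u v : ℝ, φ v - φ u = ∫ s in u..v, ε * f s (φ s) ε) ∧
        (∀ t ∈ Icc (0:ℝ) T, φ t ∈ Ioo a b) := by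
  obtain ⟨H, g, hHf, hH, hHc⟩ :=
    exists_dominatedCaratheodory_indicator_clamp hA1 hA2 hA3 hab.le habD hε₀
  have hI : ∀ x ∈ Icc a b, ∫ t in (0 : ℝ)..T, H t x 0 = ∫ t in (0 : ℝ)..T, f t x 0 :=
    fun x hx => intervalIntegral.integral_congr_Ioo_of_le hT.le fun t ht =>
      hHf t (Ioo_subset_Ioc_self ht) x hx 0
  have ha : a ∈ Icc a b := ⟨le_rfl, hab.le⟩
  have hb : b ∈ Icc a b := ⟨hab.le, le_rfl⟩
  rw [← hI a ha, ← hI b hb] at hsign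
  have hsign' : (∫ t in (0 : ℝ)..T, H t a 0) * ∫ t in (0 : ℝ)..T, H t b 0 < 0 := by
    have hT2 : 0 < (1 / T) * (1 / T) := by positivity
    rw [mul_mul_mul_comm] at hsign
    exact (pos_iff_neg_of_mul_neg hsign).1 hT2
  obtain ⟨ηa, hηa, hKa⟩ := exists_pos_forall_integral_mul_pos hε₀ hT.le hH hHc
    (left_ne_zero_of_mul hsign'.ne)
  obtain ⟨ηb, hηb, hKb⟩ := exists_pos_forall_integral_mul_pos hε₀ hT.le hH hHc
    (right_ne_zero_of_mul hsign'.ne)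
  have hg0 : 0 ≤ ∫ t, g t := integral_nonneg_of_ae
    ((hH 0 ⟨le_rfl, hε₀.le⟩).bound.mono fun t ht => (abs_nonneg _).trans (ht 0))
  let η := min ηa ηb
  have hη : 0 < η := lt_min hηa hηb
  refine ⟨min ε₀ (η / (1 + ∫ t, g t)), by positivity, min_le_left _ _, fun ε hε => ?_⟩
  have hεmem : ε ∈ Icc 0 ε₀ := ⟨hε.1, hε.2.trans (min_le_left _ _)⟩
  have hεmul : ε * (1 + ∫ t, g t) ≤ η :=
    (le_div_iff₀ (by positivity)).1 (hε.2.trans (min_le_right _ _))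
  have hεη : ε ≤ η := by nlinarith [hε.1]
  have hεg : ∫ t, ε * g t ≤ η := by
    rw [integral_const_mul]
    linarith [hε.1]
  rcases hε.1.eq_or_lt with rfl | hεpos
  · refine ⟨fun _ => (a + b) / 2, fun _ => rfl, fun _ => habD ⟨by linarith, by linarith⟩,
      fun u v => by simp, fun u v => by simp, fun t _ => ⟨by linarith, by linarith⟩⟩
  have hF := (hH ε hεmem).const_mul hεpos.le
  obtain ⟨φ, hφ, hφab, heq, hper0⟩ := hF.exists_solution_mem_Ioo
    (c := ∫ t in (0 : ℝ)..T, H t a 0) hT hab.le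
    (fun Y hY hYa => by
      have := hKa ε hεmem (hεη.trans (min_le_left _ _)) Y hY
        fun s hs => (hYa s hs).trans (hεg.trans (min_le_left _ _))
      rw [intervalIntegral.integral_const_mul, mul_left_comm]
      exact mul_pos hεpos this)
    (fun Y hY hYb => by
      have := hKb ε hεmem (hεη.trans (min_le_right _ _)) Y hY
        fun s hs => (hYb s hs).trans (hεg.trans (min_le_right _ _))
      rw [intervalIntegral.integral_const_mul, mul_left_comm]
      refine mul_neg_of_pos_of_neg hεpos ?_
      by_contra! hle
      nlinarith [mul_pos_of_neg_of_neg hsign' (neg_lt_zero.2 this), mul_nonneg hle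
        (sq_nonneg (∫ t in (0 : ℝ)..T, H t b 0))])
  have hEq : ∀ s ∈ Ioc 0 T, ε * H s (φ s) ε = ε * f s (φ s) ε := fun s hs => by
    rw [hHf s hs _ (Ioo_subset_Icc_self (hφab s (Ioc_subset_Icc_self hs)))]
  have hcongr : ∀ t ∈ Icc 0 T,
      ∫ s in (0 : ℝ)..t, ε * H s (φ s) ε = ∫ s in (0 : ℝ)..t, ε * f s (φ s) ε :=
    fun t ht => intervalIntegral.integral_congr_Ioo_of_le ht.1 fun s hs =>
      hEq s ⟨hs.1, hs.2.le.trans ht.2⟩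
  obtain ⟨ψ, hψper, hψφ, hψint, hψeq⟩ := exists_periodic_extension
    (q := fun t x => ε * f t x ε) hT (fun t x => by rw [hper]) (φ := φ)
    ((hF.integrable_superposition hφ.stronglyMeasurable).intervalIntegrable.congr_uIoo
      fun s hs => by
        rw [uIoo_of_le hT.le] at hs
        exact hEq s (Ioo_subset_Ioc_self hs))
    (fun t ht => by rw [← hcongr t ht]; exact heq t ht)
    (by rw [← hcongr T ⟨hT.le, le_rfl⟩]; exact hper0)
  have hψab : ∀ t, ψ t ∈ Ioo a b := fun t => by
    obtain ⟨s, hs, h⟩ := hψφ t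
    exact h ▸ hφab s hs
  exact ⟨ψ, hψper, fun t => habD (Ioo_subset_Icc_self (hψab t)), hψint, hψeq,
    fun t _ => hψab t⟩
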